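/- arXiv:2504.18739 — 3 statements merged into one kernel-verified Lean document; each statement's English description precedes it below -/
import Mathlib

section
/- Let d ≥ 1. There exists a constant C > 0 depending only on d such that |H_t(x) − 1| ≤ C/√t for all x ∈ ℝ^d and all t > 1. Furthermore, there exist constants C₁, C₂, C₃ > 0 depending only on d such that for all x ∈ ℝ^d: |1/H_t(x) − 1| ≤ (C₁/√t) e^{C₂/t} for 0 < t < 1, and |1/H_t(x) − 1| ≤ C₃/√t for t ≥ 1. -/
open MeasureTheory Real Filter

noncomputable section

/-- The lattice ℤ^d. -/
abbrev ZLat (d : ℕ) := Fin d → ℤ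

/-- Embedding of the lattice ℤ^d into Euclidean space ℝ^d. -/
def latVec {d : ℕ} (m : ZLat d) : EuclideanSpace ℝ (Fin d) := WithLp.toLp 2 (fun i => (m i : ℝ))

/-- The (Gaussian) heat kernel on ℝ^d. -/
def heatK (d : ℕ) (t : ℝ) (x : EuclideanSpace ℝ (Fin d)) : ℝ :=
  (2 * π * t) ^ (-(d : ℝ) / 2) * Real.exp (-‖x‖ ^ 2 / (2 * t))

/-- The periodic heat kernel H_t(x) = Σ_{n ∈ ℤ^d} P_t(x − n). -/
def pHeatK (d : ℕ) (t : ℝ) (x : EuclideanSpace ℝ (Fin d)) : ℝ :=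
  ∑' n : ZLat d, heatK d t (x - latVec n)

/-- Partial derivative in the j-th coordinate direction. -/
def pderiv {d : ℕ} (j : Fin d) (f : EuclideanSpace ℝ (Fin d) → ℝ)
    (x : EuclideanSpace ℝ (Fin d)) : ℝ :=
  fderiv ℝ f x (EuclideanSpace.single j 1)

/-- The constant c_d = π^{-d/2} Γ((d+2)/2). -/
def cConst (d : ℕ) : ℝ := π ^ (-(d : ℝ) / 2) * Real.Gamma (((d : ℝ) + 2) / 2)

/-- The discrete second-order Riesz kernel K_dis^{(jk)}. -/
def discK (d : ℕ) (j k : Fin d) (m : ZLat d) : ℝ :=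
  if m = 0 then 0 else cConst d * (m j : ℝ) * (m k : ℝ) / ‖latVec m‖ ^ (d + 2)

/-- The discrete second-order Riesz transform R_dis^{(jk)}. -/
def Rdis (d : ℕ) (j k : Fin d) (f : ZLat d → ℝ) (n : ZLat d) : ℝ :=
  ∑' m : ZLat d, discK d j k m * f (n - m)

/-- The probabilistic kernel 𝒦^{(jk)}(m). -/
def probK (d : ℕ) (j k : Fin d) (m : ZLat d) : ℝ :=
  -∫ s in Set.Ioi (0 : ℝ), ∫ x : EuclideanSpace ℝ (Fin d),
      pHeatK d s x *
        (pderiv j (fun y => heatK d s y / pHeatK d s y) x *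
         pderiv k (fun y => heatK d s (y - latVec m) / pHeatK d s y) x)

/-- The probabilistic discrete second-order Riesz transform 𝓡^{(jk)}. -/
def Rprob (d : ℕ) (j k : Fin d) (f : ZLat d → ℝ) (n : ZLat d) : ℝ :=
  ∑' m : ZLat d, probK d j k (n - m) * f m

/-- The ℓ^p norm of f : ℤ^d → ℝ. -/
def lpN (d : ℕ) (p : ℝ) (f : ZLat d → ℝ) : ℝ := (∑' n : ZLat d, |f n| ^ p) ^ (1 / p)

/-- Membership in ℓ^p(ℤ^d). -/
def MemLpLat (d : ℕ) (p : ℝ) (f : ZLat d → ℝ) : Prop := Summable fun n : ZLat d => |f n| ^ p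

/-- Operator norm of an operator on ℓ^p(ℤ^d): sup of ‖Tf‖ over ‖f‖ = 1. -/
def opN (d : ℕ) (p : ℝ) (T : (ZLat d → ℝ) → (ZLat d → ℝ)) : ℝ :=
  sSup {c : ℝ | ∃ f : ZLat d → ℝ, MemLpLat d p f ∧ lpN d p f = 1 ∧ c = lpN d p (T f)}

/-- p* = max{p, p/(p-1)}. -/
def pstar (p : ℝ) : ℝ := max p (p / (p - 1))


def gOne (t y : ℝ) (n : ℤ) : ℝ := (√(2 * π * t))⁻¹ * Real.exp (-(y - n) ^ 2 / (2 * t))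

def hOne (t y : ℝ) : ℝ := ∑' n : ℤ, gOne t y n

lemma gOne_nonneg (t y : ℝ) (n : ℤ) : 0 ≤ gOne t y n := by unfold gOne; positivity

lemma gOne_summable {t : ℝ} (ht : 0 < t) (y : ℝ) : Summable (gOne t y) := by
  have h := (HurwitzKernelBounds.summable_f_int 0 (-y) (t := 1 / (2 * π * t))
    (by positivity)).mul_left (√(2 * π * t))⁻¹
  refine h.congr fun n => ?_
  unfold gOne HurwitzKernelBounds.f_int
  simp only [pow_zero, one_mul]
  congr 2
  have := Real.pi_pos
  field_simp
  ring

lemma hasSum_pi_aux (d : ℕ) : ∀ (f : Fin d → ℤ → ℝ) (_ : ∀ i n, 0 ≤ f i n)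
    (_ : ∀ i, Summable (f i)),
    HasSum (fun n : Fin d → ℤ => ∏ i, f i (n i)) (∏ i, ∑' k, f i k) := by
  induction d with
  | zero =>
    intro f _ _
    simp
  | succ d ih =>
    intro f h0 hs
    have h1 := ih (fun i => f i.succ) (fun i => h0 _) (fun i => hs _)
    have hn : 0 ≤ fun n : Fin d → ℤ => ∏ i, f (Fin.succ i) (n i) := by
      intro n
      exact Finset.prod_nonneg fun i _ => h0 _ _
    have hn0 : 0 ≤ f 0 := by
      intro n
      exact h0 0 n
    have hsm := Summable.mul_of_nonneg (hs 0) h1.summable hn0 hn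
    have h2 := HasSum.mul (hs 0).hasSum h1 hsm
    rw [← (Fin.consEquiv (fun _ : Fin (d + 1) => ℤ)).hasSum_iff, Fin.prod_univ_succ]
    have e : ((fun n : Fin (d + 1) → ℤ => ∏ i, f i (n i)) ∘
        (Fin.consEquiv (fun _ : Fin (d + 1) => ℤ)))
        = fun p : ℤ × (Fin d → ℤ) => f 0 p.1 * ∏ i, f (Fin.succ i) (p.2 i) := by
      funext p
      simp [Fin.consEquiv, Fin.prod_univ_succ]
    rw [e]
    exact h2

lemma heatK_eq {d : ℕ} {t : ℝ} (ht : 0 < t) (x : EuclideanSpace ℝ (Fin d)) (n : ZLat d) :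
    heatK d t (x - latVec n) = ∏ i, gOne t (x i) (n i) := by
  unfold heatK gOne latVec
  rw [Finset.prod_mul_distrib, ← Real.exp_sum, EuclideanSpace.real_norm_sq_eq]
  congr 1
  · have h : 0 < 2 * π * t := by positivity
    rw [Finset.prod_const, Finset.card_univ, Fintype.card_fin, Real.sqrt_eq_rpow,
      ← Real.rpow_neg h.le, ← Real.rpow_natCast, ← Real.rpow_mul h.le]
    congr 1
    ring
  · congr 1
    rw [← Finset.sum_div, Finset.sum_neg_distrib]
    simp

lemma pHeatK_eq {d : ℕ} {t : ℝ} (ht : 0 < t) (x : EuclideanSpace ℝ (Fin d)) :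
    pHeatK d t x = ∏ i, hOne t (x i) := by
  unfold pHeatK
  simp_rw [heatK_eq ht]
  exact (hasSum_pi_aux d (fun i => gOne t (x i)) (fun i n => gOne_nonneg _ _ _)
    (fun i => gOne_summable ht _)).tsum_eq

lemma hOne_lower {t : ℝ} (ht : 0 < t) (ht1 : t < 1) (y : ℝ) :
    (3 * Real.exp (1 / 8 / t))⁻¹ ≤ hOne t y := by
  have h1 : gOne t y (round y) ≤ hOne t y :=
    (gOne_summable ht y).le_tsum _ (fun n _ => gOne_nonneg _ _ _)
  refine le_trans ?_ h1
  unfold gOne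
  rw [mul_inv, ← Real.exp_neg]
  have hpi := Real.pi_lt_d2
  have hpos := Real.pi_pos
  have h2 : √(2 * π * t) ≤ 3 := by
    rw [Real.sqrt_le_left (by norm_num)]
    nlinarith
  have h3 : (y - round y) ^ 2 ≤ 1 / 4 := by
    have := abs_sub_round y
    rw [← sq_abs]
    nlinarith [abs_nonneg (y - round y)]
  have h4 : -(1 / 8 / t) ≤ -(y - round y) ^ 2 / (2 * t) := by
    rw [neg_div, neg_le_neg_iff, div_div, div_le_div_iff₀ (by positivity) (by positivity)]
    nlinarith
  have : 0 < √(2 * π * t) := by positivity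
  gcongr

lemma hOne_fourier {t : ℝ} (ht : 0 < t) (y : ℝ) :
    ((hOne t y : ℝ) : ℂ) = ∑' n : ℤ, Complex.exp (-π * (2 * π * t : ℝ) * n ^ 2
      + 2 * π * (Complex.I * y) * n) := by
  have hpos := Real.pi_pos
  have h : 0 < 2 * π * t := by positivity
  rw [Complex.tsum_exp_neg_quadratic (by rw [Complex.ofReal_re]; exact h)]
  unfold hOne gOne
  rw [tsum_mul_left, Complex.ofReal_mul, Complex.ofReal_tsum, Real.sqrt_eq_rpow,
    Complex.ofReal_inv, Complex.ofReal_cpow h.le, one_div]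
  congr 1
  · norm_num
  · refine tsum_congr fun n => ?_
    rw [Complex.ofReal_exp]
    congr 1
    rw [← mul_assoc, Complex.I_mul_I]
    have : (π : ℂ) ≠ 0 := by exact_mod_cast hpos.ne'
    have : (t : ℂ) ≠ 0 := by exact_mod_cast ht.ne'
    push_cast
    field_simp
    ring

lemma hOne_bound {t : ℝ} (ht : 1 ≤ t) (y : ℝ) : |hOne t y - 1| ≤ 1 / 2 / √t := by
  have hpos := Real.pi_pos
  have hpi := Real.pi_gt_three
  have ht0 : 0 < t := by linarith
  set q := Real.exp (-π * (2 * π * t)) with hq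
  have hq0 : 0 < q := Real.exp_pos _
  have hqt : q ≤ 1 / (18 * t) := by
    rw [hq, neg_mul, Real.exp_neg, one_div]
    apply inv_anti₀ (by positivity)
    have := Real.add_one_le_exp (π * (2 * π * t))
    have : 9 ≤ π * π := by nlinarith
    nlinarith
  have hq18 : q ≤ 1 / 18 := hqt.trans (by
    apply one_div_le_one_div_of_le <;> linarith)
  set F : ℤ → ℂ := fun n => Complex.exp (-π * (2 * π * t : ℝ) * n ^ 2
      + 2 * π * (Complex.I * y) * n) with hF
  have hFn : ∀ n, ‖F n‖ ≤ q ^ n.natAbs := by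
    intro n
    have h := norm_exp_mul_sq_le (τ := (2 * π * t : ℝ) * Complex.I)
      (by simp; positivity) n
    have e : ((2 * π * t : ℝ) * Complex.I).im = 2 * π * t := by simp
    rw [e] at h
    refine le_trans (le_of_eq ?_) h
    rw [hF]
    simp only
    rw [Complex.norm_exp, Complex.norm_exp]
    congr 1
    have e1 : (-π * (2 * π * t : ℝ) * n ^ 2 + 2 * π * (Complex.I * y) * n : ℂ)
      = ((-π * (2 * π * t) * n ^ 2 : ℝ) : ℂ) + ((2 * π * y * n : ℝ) : ℂ) * Complex.I := by
      push_cast; ring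
    have e2 : (π * Complex.I * n ^ 2 * ((2 * π * t : ℝ) * Complex.I) : ℂ)
      = ((-π * (2 * π * t) * n ^ 2 : ℝ) : ℂ) := by
      push_cast
      linear_combination (2 * π ^ 2 * n ^ 2 * t : ℂ) * Complex.I_mul_I
    rw [e1, e2]
    simp only [Complex.add_re, Complex.re_ofReal_mul, Complex.I_re, Complex.ofReal_re]
    ring
  set g : ℤ → ℝ := fun n => if n = 0 then 0 else q ^ n.natAbs with hg
  have s : HasSum (fun n : ℕ => q ^ (n + 1)) (q / (1 - q)) := by
    simp_rw [pow_succ', div_eq_mul_inv, hasSum_mul_left_iff hq0.ne']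
    exact hasSum_geometric_of_lt_one hq0.le (by linarith)
  have s1 : HasSum (fun n : ℕ => g n) (q / (1 - q)) := by
    rw [← hasSum_nat_add_iff' 1]
    have e1 : (fun n : ℕ => g ((n + 1 : ℕ) : ℤ)) = fun n : ℕ => q ^ (n + 1) := by
      funext n
      have h : ((n + 1 : ℕ) : ℤ) ≠ 0 := by omega
      simp only [hg]
      rw [if_neg h, Int.natAbs_natCast]
    have e2 : ∑ i ∈ Finset.range 1, g (i : ℤ) = 0 := by simp [hg]
    rw [e2, sub_zero]
    exact (congrArg (fun φ => HasSum φ (q / (1 - q))) e1).mpr s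
  have s2 : HasSum (fun n : ℕ => g (-n)) (q / (1 - q)) := by
    have e1 : (fun n : ℕ => g (-(n : ℤ))) = fun n : ℕ => g n := by
      funext n
      simp only [hg, neg_eq_zero, Int.natAbs_neg]
    rw [e1]
    exact s1
  have s3 : HasSum g (2 * (q / (1 - q))) := by
    have h := s1.of_nat_of_neg s2
    have e0 : g 0 = 0 := if_pos rfl
    rw [e0, sub_zero, ← two_mul] at h
    exact h
  have hle : ∀ n, ‖(fun n => F n - if n = 0 then 1 else 0) n‖ ≤ g n := by
    intro n
    by_cases h : n = 0
    · simp [h, hg, hF]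
    · simpa [h, hg] using hFn n
  have hGs : Summable (fun n => F n - if n = 0 then 1 else 0) :=
    Summable.of_norm_bounded s3.summable hle
  have hS : HasSum (fun n : ℤ => if n = 0 then (1 : ℂ) else 0) 1 := hasSum_ite_eq 0 1
  have hFs : HasSum F (∑' n, F n) := by
    refine Summable.hasSum ?_
    have := hGs.add hS.summable
    simpa using this
  have key : ‖(∑' n, F n) - 1‖ ≤ 2 * (q / (1 - q)) := by
    rw [← (hFs.sub hS).tsum_eq]
    exact tsum_of_norm_bounded s3 hle
  rw [← hOne_fourier ht0 y, ← Complex.ofReal_one, ← Complex.ofReal_sub, Complex.norm_real,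
    Real.norm_eq_abs] at key
  refine key.trans ?_
  have h5 : q / (1 - q) ≤ 2 * q := by
    rw [div_le_iff₀ (by linarith)]
    nlinarith
  have h6 : √t ≤ t := by
    rw [Real.sqrt_le_left ht0.le]; nlinarith
  have h7 : 0 < √t := by positivity
  calc 2 * (q / (1 - q)) ≤ 4 * (1 / (18 * t)) := by linarith
    _ ≤ 1 / 2 / t := by
      have : 4 * (1 / (18 * t)) = (2 / 9) / t := by field_simp; norm_num
      rw [this]; exact div_le_div_of_nonneg_right (by norm_num) ht0.le
    _ ≤ 1 / 2 / √t := by gcongr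

lemma hOne_half {t : ℝ} (ht : 1 ≤ t) (y : ℝ) : 1 / 2 ≤ hOne t y := by
  have h := hOne_bound ht y
  have h1 : 1 / 2 / √t ≤ 1 / 2 := by
    apply div_le_self (by norm_num)
    rw [Real.one_le_sqrt]; exact ht
  have := (abs_le.1 (h.trans h1)).1
  linarith

lemma pHeatK_bound {d : ℕ} {t : ℝ} (ht : 1 ≤ t) (x : EuclideanSpace ℝ (Fin d)) :
    |pHeatK d t x - 1| ≤ (d * Real.exp d) / √t := by
  rw [pHeatK_eq (by linarith)]
  have h := Finset.norm_prod_one_add_sub_one_le Finset.univ (fun i => hOne t (x i) - 1)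
  simp only [add_sub_cancel, Real.norm_eq_abs] at h
  refine h.trans ?_
  have h1s : 1 ≤ √t := by rw [Real.one_le_sqrt]; exact ht
  have hs : ∑ i : Fin d, |hOne t (x i) - 1| ≤ d / √t := by
    calc ∑ i : Fin d, |hOne t (x i) - 1| ≤ ∑ i : Fin d, 1 / √t := by
          refine Finset.sum_le_sum fun i _ => (hOne_bound ht _).trans ?_
          gcongr; norm_num
      _ = d / √t := by simp; ring
  set u : ℝ := d / √t with hu
  have hu0 : 0 ≤ u := by positivity
  have hud : u ≤ d := div_le_self (by positivity) h1s
  have h3 : Real.exp u - 1 ≤ u * Real.exp u := by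
    have h4 := Real.add_one_le_exp (-u)
    have h5 : Real.exp (-u) * Real.exp u = 1 := by rw [← Real.exp_add]; simp
    nlinarith [Real.exp_pos u]
  calc Real.exp (∑ i : Fin d, |hOne t (x i) - 1|) - 1 ≤ Real.exp u - 1 := by gcongr
    _ ≤ u * Real.exp u := h3
    _ ≤ u * Real.exp d := by gcongr
    _ = _ := by rw [hu]; ring

theorem stmt3 (d : ℕ) (hd : 1 ≤ d) :
    (∃ C : ℝ, 0 < C ∧ ∀ (x : EuclideanSpace ℝ (Fin d)) (t : ℝ), 1 < t →
      |pHeatK d t x - 1| ≤ C / Real.sqrt t) ∧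
    (∃ C₁ C₂ C₃ : ℝ, 0 < C₁ ∧ 0 < C₂ ∧ 0 < C₃ ∧ ∀ x : EuclideanSpace ℝ (Fin d),
      (∀ t : ℝ, 0 < t → t < 1 →
        |1 / pHeatK d t x - 1| ≤ C₁ / Real.sqrt t * Real.exp (C₂ / t)) ∧
      (∀ t : ℝ, 1 ≤ t → |1 / pHeatK d t x - 1| ≤ C₃ / Real.sqrt t)) := by

  have hd0 : (0 : ℝ) < d := by exact_mod_cast hd
  refine ⟨⟨d * Real.exp d, by positivity, fun x t ht => pHeatK_bound ht.le x⟩, 3 ^ d + 1, d * (1 / 8),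
    2 ^ d * (d * Real.exp d), by positivity, by positivity, by positivity,
    fun x => ⟨fun t ht ht1 => ?_, fun t ht => ?_⟩⟩
  · have hl : (3 ^ d * Real.exp (d * (1 / 8) / t))⁻¹ ≤ pHeatK d t x := by
      rw [pHeatK_eq ht]
      calc (3 ^ d * Real.exp (d * (1 / 8) / t))⁻¹
          = ∏ i : Fin d, (3 * Real.exp (1 / 8 / t))⁻¹ := by
            rw [Finset.prod_const, Finset.card_univ, Fintype.card_fin, inv_pow, mul_pow,
              ← Real.exp_nat_mul, mul_div_assoc]
        _ ≤ _ := Finset.prod_le_prod (fun i _ => by positivity) fun i _ => hOne_lower ht ht1 _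
    have hE : 1 ≤ Real.exp (d * (1 / 8) / t) := Real.one_le_exp (by positivity)
    set E := Real.exp (d * (1 / 8) / t)
    have h0 : 0 < pHeatK d t x := lt_of_lt_of_le (by positivity) hl
    have h1 : 1 / pHeatK d t x ≤ 3 ^ d * E := by
      rw [one_div]
      exact inv_le_of_inv_le₀ (by positivity) hl
    have h2 : 0 < 1 / pHeatK d t x := by positivity
    have h3 : (3 : ℝ) ^ d + 1 ≤ (3 ^ d + 1) / √t := by
      rw [le_div_iff₀ (by positivity)]
      apply mul_le_of_le_one_right (by positivity)
      rw [Real.sqrt_le_left (by norm_num)]; linarith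
    calc |1 / pHeatK d t x - 1| ≤ (3 ^ d + 1) * E := by
          have : 0 < (3 : ℝ) ^ d * E := by positivity
          rw [abs_le]; constructor <;> nlinarith
      _ ≤ _ := by gcongr
  · have hl : (1 / 2) ^ d ≤ pHeatK d t x := by
      rw [pHeatK_eq (by linarith)]
      calc ((1 : ℝ) / 2) ^ d = ∏ i : Fin d, (1 / 2 : ℝ) := by simp
        _ ≤ _ := Finset.prod_le_prod (fun i _ => by positivity) fun i _ => hOne_half ht _
    have h0 : 0 < pHeatK d t x := lt_of_lt_of_le (by positivity) hl
    have h1 : 1 / pHeatK d t x ≤ 2 ^ d := by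
      rw [one_div]
      refine inv_le_of_inv_le₀ (by positivity) ?_
      simpa using hl
    have h2 : 1 / pHeatK d t x - 1 = -(1 / pHeatK d t x * (pHeatK d t x - 1)) := by
      field_simp; ring
    rw [h2, abs_neg, abs_mul, abs_of_pos (by positivity), mul_div_assoc]
    gcongr
    exact pHeatK_bound ht x

end
end

section
/- Let d ≥ 1. There exist constants C₁, C₂ > 0 depending only on d such that for all x ∈ ℝ^d and t > 0, the gradient of x ↦ log H_t(x) satisfies |∇_x log H_t(x)| ≤ C₁/t when 0 < t < 1, and |∇_x log H_t(x)| ≤ C₂/√t when t ≥ 1. -/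
open MeasureTheory Real Filter

noncomputable section

lemma aux_summable_one (a : ℝ) (ha : 0 < a) :
    Summable fun k : ℤ => Real.exp (-a * (k : ℝ) ^ 2) := by
  have h : Summable fun k : ℕ => Real.exp (-a * (k : ℝ) ^ 2) := by
    have h1 : Summable fun k : ℕ => Real.exp ((k : ℝ) * (-a)) :=
      Real.summable_exp_nat_mul_iff.2 (by linarith)
    refine Summable.of_nonneg_of_le (fun _ => (Real.exp_pos _).le) (fun k => ?_) h1
    apply Real.exp_le_exp.2
    have : (k : ℝ) ≤ (k : ℝ) ^ 2 := by
      exact_mod_cast Nat.le_self_pow (by norm_num) k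
    nlinarith
  refine Summable.of_nat_of_neg ?_ ?_
  · simpa using h
  · simpa using h

lemma aux_summable_prod (f : ℤ → ℝ) (hf : ∀ k, 0 ≤ f k) (hs : Summable f) (d : ℕ) :
    Summable fun n : ZLat d => ∏ i, f (n i) := by
  induction d with
  | zero => exact Summable.of_finite
  | succ d ih =>
    have h := hs.mul_of_nonneg ih hf (fun n => Finset.prod_nonneg fun i _ => hf _)
    rw [← (Fin.consEquiv (fun _ : Fin (d + 1) => ℤ)).summable_iff]
    refine h.congr fun p => ?_
    simp [Fin.prod_univ_succ, Fin.consEquiv]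

lemma aux_latVec_apply {d : ℕ} (m : ZLat d) (i : Fin d) : latVec m i = (m i : ℝ) := rfl

lemma aux_normsq_lat {d : ℕ} (m : ZLat d) : ‖latVec m‖ ^ 2 = ∑ i, (m i : ℝ) ^ 2 := by
  rw [EuclideanSpace.real_norm_sq_eq]; rfl

lemma aux_summable (d : ℕ) (a : ℝ) (ha : 0 < a) :
    Summable fun n : ZLat d => Real.exp (-a * ‖latVec n‖ ^ 2) := by
  refine (aux_summable_prod _ (fun _ => (Real.exp_pos _).le) (aux_summable_one a ha) d).congr
    fun n => ?_
  rw [← Real.exp_sum, aux_normsq_lat, Finset.mul_sum]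

/-- doubling bound at the origin -/
lemma aux_doubling (d : ℕ) (a : ℝ) (ha : 0 < a) :
    ∑' n : ZLat d, Real.exp (-(a / 16) * ‖latVec n‖ ^ 2)
      ≤ 7 ^ d * ∑' n : ZLat d, Real.exp (-a * ‖latVec n‖ ^ 2) := by
  have hs := aux_summable d a ha
  let S := Fin d → Finset.Icc (-3 : ℤ) 3
  have hmod : ∀ k : ℤ, Int.tmod k 4 ∈ Finset.Icc (-3 : ℤ) 3 := by
    intro k
    rw [Finset.mem_Icc]
    have h := Int.natAbs_tmod k 4
    have h' : Int.natAbs 4 = 4 := rfl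
    rw [h'] at h
    omega
  let φ : ZLat d → S × ZLat d :=
    fun m => (fun i => ⟨Int.tmod (m i) 4, hmod _⟩, fun i => Int.tdiv (m i) 4)
  have hφ : Function.Injective φ := by
    intro m m' h
    funext i
    have h1 : Int.tmod (m i) 4 = Int.tmod (m' i) 4 := by
      have := congrFun (congrArg Prod.fst h) i
      simpa [φ] using this
    have h2 : Int.tdiv (m i) 4 = Int.tdiv (m' i) 4 := congrFun (congrArg Prod.snd h) i
    rw [← Int.mul_tdiv_add_tmod (m i) 4, ← Int.mul_tdiv_add_tmod (m' i) 4, h1, h2]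
  let g : S × ZLat d → ℝ := fun p => 1 * Real.exp (-a * ‖latVec p.2‖ ^ 2)
  have hg : Summable g :=
    (Summable.of_finite (f := fun _ : S => (1 : ℝ))).mul_of_nonneg hs (fun _ => zero_le_one)
      (fun _ => (Real.exp_pos _).le)
  have hsum : ∑' p, g p = 7 ^ d * ∑' n : ZLat d, Real.exp (-a * ‖latVec n‖ ^ 2) := by
    rw [hg.tsum_prod]
    simp only [g, one_mul, tsum_fintype, Finset.sum_const, nsmul_eq_mul]
    congr 1
    simp [S]
  rw [← hsum]
  refine Summable.tsum_le_tsum_of_inj φ hφ (fun p _ => by positivity) (fun m => ?_)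
    (aux_summable d _ (by positivity)) hg
  simp only [g, φ, one_mul]
  apply Real.exp_le_exp.2
  rw [aux_normsq_lat, aux_normsq_lat]
  have : ∑ i, ((Int.tdiv (m i) 4 : ℤ) : ℝ) ^ 2 ≤ (∑ i, (m i : ℝ) ^ 2) / 16 := by
    rw [Finset.sum_div]
    refine Finset.sum_le_sum fun i _ => ?_
    have h1 : |Int.tdiv (m i) 4| * 4 ≤ |m i| := by
      have h := Int.natAbs_tdiv (m i) 4
      have h' : Int.natAbs 4 = 4 := rfl
      rw [h'] at h
      rw [Int.abs_eq_natAbs, Int.abs_eq_natAbs, h]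
      exact_mod_cast Nat.div_mul_le_self (m i).natAbs 4
    have h2 : (Int.tdiv (m i) 4) ^ 2 * 16 ≤ (m i) ^ 2 := by
      rw [← sq_abs, ← sq_abs (m i)]
      nlinarith [abs_nonneg (Int.tdiv (m i) 4), abs_nonneg (m i)]
    have h3 : ((Int.tdiv (m i) 4 : ℤ) : ℝ) ^ 2 * 16 ≤ (m i : ℝ) ^ 2 := by exact_mod_cast h2
    linarith
  nlinarith

/-- un-normalised Gaussian weight -/
def auxG {d : ℕ} (t : ℝ) (x : EuclideanSpace ℝ (Fin d)) (n : ZLat d) : ℝ :=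
  Real.exp (-‖x - latVec n‖ ^ 2 / (2 * t))

lemma auxG_pos {d : ℕ} (t : ℝ) (x : EuclideanSpace ℝ (Fin d)) (n : ZLat d) : 0 < auxG t x n :=
  Real.exp_pos _

lemma aux_low {d : ℕ} (x : EuclideanSpace ℝ (Fin d)) (n : ZLat d) :
    ‖latVec n‖ ^ 2 / 2 - ‖x‖ ^ 2 ≤ ‖x - latVec n‖ ^ 2 := by
  have h := norm_sub_norm_le (latVec n) x
  rw [norm_sub_rev] at h
  nlinarith [norm_nonneg x, norm_nonneg (latVec n), norm_nonneg (x - latVec n),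
    sq_nonneg (‖x‖ - ‖x - latVec n‖), sq_nonneg (‖x‖ + ‖x - latVec n‖)]

lemma aux_up {d : ℕ} (x : EuclideanSpace ℝ (Fin d)) (n : ZLat d) :
    ‖x - latVec n‖ ^ 2 ≤ 2 * ‖latVec n‖ ^ 2 + 2 * ‖x‖ ^ 2 := by
  have h := norm_sub_le x (latVec n)
  nlinarith [norm_nonneg x, norm_nonneg (latVec n), norm_nonneg (x - latVec n),
    sq_nonneg (‖x‖ - ‖latVec n‖)]

lemma aux_half {d : ℕ} (t : ℝ) (ht : 0 < t) (x : EuclideanSpace ℝ (Fin d)) (n : ZLat d) :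
    Real.exp (-‖x - latVec n‖ ^ 2 / (4 * t)) ≤
      Real.exp (‖x‖ ^ 2 / (4 * t)) * Real.exp (-(2 / t / 16) * ‖latVec n‖ ^ 2) := by
  rw [← Real.exp_add]
  apply Real.exp_le_exp.2
  have := aux_low x n
  have e : ‖x‖ ^ 2 / (4 * t) + -(2 / t / 16) * ‖latVec n‖ ^ 2
      = -(‖latVec n‖ ^ 2 / 2 - ‖x‖ ^ 2) / (4 * t) := by field_simp; ring
  rw [e]
  gcongr

lemma aux_rG {d : ℕ} (t : ℝ) (ht : 0 < t) (x : EuclideanSpace ℝ (Fin d)) (n : ZLat d) :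
    ‖x - latVec n‖ * auxG t x n ≤ √t * Real.exp (-‖x - latVec n‖ ^ 2 / (4 * t)) := by
  set r := ‖x - latVec n‖ with hr
  have hs : 0 < √t := Real.sqrt_pos.2 ht
  have hs2 : √t ^ 2 = t := Real.sq_sqrt ht.le
  have e : auxG t x n = Real.exp (-r ^ 2 / (4 * t)) * Real.exp (-(r ^ 2 / (4 * t))) := by
    rw [auxG, ← Real.exp_add, ← hr]; congr 1; field_simp; ring
  have h1 : r ≤ √t * Real.exp (r ^ 2 / (4 * t)) := by
    have h2 := Real.add_one_le_exp (r ^ 2 / (4 * t))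
    have h3 : r ≤ √t * (r ^ 2 / (4 * t) + 1) := by
      have : √t * (r ^ 2 / (4 * t) + 1) - r = (r / 2 - √t) ^ 2 / √t := by
        rw [← hs2]
        field_simp
        rw [Real.sqrt_sq hs.le]
        field_simp
        ring
      have h4 : 0 ≤ (r / 2 - √t) ^ 2 / √t := by positivity
      linarith
    exact h3.trans (by gcongr)
  have h5 : r * Real.exp (-(r ^ 2 / (4 * t))) ≤ √t := by
    rw [Real.exp_neg, ← div_eq_mul_inv, div_le_iff₀ (Real.exp_pos _)]; exact h1
  rw [e]
  nlinarith [Real.exp_pos (-r ^ 2 / (4 * t))]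

lemma auxG_le {d : ℕ} (t : ℝ) (ht : 0 < t) (x : EuclideanSpace ℝ (Fin d)) (n : ZLat d) :
    auxG t x n ≤ Real.exp (-‖x - latVec n‖ ^ 2 / (4 * t)) := by
  apply Real.exp_le_exp.2
  rw [neg_div, neg_div, neg_le_neg_iff]
  gcongr
  norm_num

lemma auxG_summable {d : ℕ} (t : ℝ) (ht : 0 < t) (x : EuclideanSpace ℝ (Fin d)) :
    Summable (auxG t x) :=
  Summable.of_nonneg_of_le (fun n => (auxG_pos t x n).le)
    (fun n => (auxG_le t ht x n).trans (aux_half t ht x n))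
    ((aux_summable d (2 / t / 16) (by positivity)).mul_left _)

lemma aux_rG_summable {d : ℕ} (t : ℝ) (ht : 0 < t) (x : EuclideanSpace ℝ (Fin d)) :
    Summable fun n => ‖x - latVec n‖ * auxG t x n :=
  Summable.of_nonneg_of_le (fun n => mul_nonneg (norm_nonneg _) (auxG_pos t x n).le)
    (fun n => (aux_rG t ht x n).trans
      (mul_le_mul_of_nonneg_left (aux_half t ht x n) (Real.sqrt_nonneg t)))
    (((aux_summable d (2 / t / 16) (by positivity)).mul_left _).mul_left _)

lemma aux_rG_tsum_le {d : ℕ} (t : ℝ) (ht : 0 < t) (x : EuclideanSpace ℝ (Fin d)) :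
    ∑' n, ‖x - latVec n‖ * auxG t x n ≤ √t * (Real.exp (‖x‖ ^ 2 / (4 * t)) *
      ∑' n : ZLat d, Real.exp (-(2 / t / 16) * ‖latVec n‖ ^ 2)) := by
  rw [← tsum_mul_left, ← tsum_mul_left]
  exact (aux_rG_summable t ht x).tsum_le_tsum (fun n => (aux_rG t ht x n).trans
      (mul_le_mul_of_nonneg_left (aux_half t ht x n) (Real.sqrt_nonneg t)))
    (((aux_summable d (2 / t / 16) (by positivity)).mul_left _).mul_left _)

/-- large time bound, reduced point -/
lemma aux_large {d : ℕ} (t : ℝ) (ht : 1 ≤ t) (x : EuclideanSpace ℝ (Fin d))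
    (hx : ‖x‖ ^ 2 ≤ d) :
    ∑' n, ‖x - latVec n‖ * auxG t x n ≤
      (Real.exp (2 * d) * 7 ^ d) * √t * ∑' n, auxG t x n := by
  have ht0 : 0 < t := by linarith
  have h1 := aux_rG_tsum_le t ht0 x
  have h2 := aux_doubling d (2 / t) (by positivity)
  have h3 : ∑' n : ZLat d, Real.exp (-(2 / t) * ‖latVec n‖ ^ 2) ≤
      Real.exp d * ∑' n, auxG t x n := by
    rw [← tsum_mul_left]
    refine (aux_summable d _ (by positivity)).tsum_le_tsum (fun n => ?_)
      ((auxG_summable t ht0 x).mul_left _)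
    rw [auxG, ← Real.exp_add]
    apply Real.exp_le_exp.2
    have h4 := aux_up x n
    have h5 : ‖x - latVec n‖ ^ 2 / (2 * t) ≤ (2 * ‖latVec n‖ ^ 2 + 2 * d) / (2 * t) := by
      gcongr; linarith
    have h6 : (2 * ‖latVec n‖ ^ 2 + 2 * d) / (2 * t) = 1 / t * ‖latVec n‖ ^ 2 + d / t := by
      field_simp
    have h7 : (d : ℝ) / t ≤ d := div_le_self (by positivity) ht
    have h8 : 1 / t * ‖latVec n‖ ^ 2 ≤ 2 / t * ‖latVec n‖ ^ 2 := by gcongr; norm_num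
    rw [neg_div]
    linarith
  have h9 : Real.exp (‖x‖ ^ 2 / (4 * t)) ≤ Real.exp d := by
    apply Real.exp_le_exp.2
    rw [div_le_iff₀ (by positivity)]
    have : (0 : ℝ) ≤ d := by positivity
    nlinarith
  calc _ ≤ _ := h1
    _ ≤ √t * (Real.exp d * (7 ^ d * (Real.exp d * ∑' n, auxG t x n))) := by
        have : 0 ≤ ∑' n : ZLat d, Real.exp (-(2 / t / 16) * ‖latVec n‖ ^ 2) :=
          tsum_nonneg fun _ => (Real.exp_pos _).le
        gcongr
        exact h2.trans (by gcongr)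
    _ = _ := by
        rw [show (2 : ℝ) * d = d + d by ring, Real.exp_add]; ring

/-- small time bound, reduced point -/
lemma aux_small (d : ℕ) : ∃ C : ℝ, 0 < C ∧ ∀ (t : ℝ), 0 < t → t < 1 →
    ∀ (x : EuclideanSpace ℝ (Fin d)), ‖x‖ ^ 2 ≤ d →
    (∀ n : ZLat d, ‖x‖ ^ 2 ≤ ‖x - latVec n‖ ^ 2) →
    ∑' n, ‖x - latVec n‖ * auxG t x n ≤ C * ∑' n, auxG t x n := by
  set A := ∑' n : ZLat d, Real.exp (-(2 / 1 / 16) * ‖latVec n‖ ^ 2) with hA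
  have hA0 : 0 ≤ A := tsum_nonneg fun _ => (Real.exp_pos _).le
  refine ⟨Real.exp d * (Real.exp d * A) + 1, by positivity, ?_⟩
  intro t ht ht1 x hx hmin
  have hZ : Real.exp (-‖x‖ ^ 2 / (2 * t)) ≤ ∑' n, auxG t x n := by
    have h := (auxG_summable t ht x).le_tsum (0 : ZLat d) (fun n _ => (auxG_pos t x n).le)
    have e : latVec (0 : ZLat d) = 0 := by ext i; simp [latVec]
    simpa [auxG, e] using h
  have hd0 : (0 : ℝ) ≤ d := by positivity
  have h1 := aux_rG_tsum_le 1 one_pos x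
  rw [← hA, Real.sqrt_one, one_mul] at h1
  have h2 : Real.exp (‖x‖ ^ 2 / (4 * 1)) ≤ Real.exp d := by
    apply Real.exp_le_exp.2; nlinarith
  have h3 : ∑' n, ‖x - latVec n‖ * auxG t x n ≤
      (Real.exp (-‖x‖ ^ 2 / (2 * t)) * Real.exp d) * ∑' n, ‖x - latVec n‖ * auxG 1 x n := by
    rw [← tsum_mul_left]
    refine (aux_rG_summable t ht x).tsum_le_tsum (fun n => ?_)
      ((aux_rG_summable 1 one_pos x).mul_left _)
    have : auxG t x n ≤ Real.exp (-‖x‖ ^ 2 / (2 * t)) * Real.exp d * auxG 1 x n := by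
      rw [auxG, auxG, ← Real.exp_add, ← Real.exp_add]
      apply Real.exp_le_exp.2
      have h4 : (‖x - latVec n‖ ^ 2 - ‖x‖ ^ 2) / (2 * 1) ≤
          (‖x - latVec n‖ ^ 2 - ‖x‖ ^ 2) / (2 * t) := by
        have := hmin n
        have h0 : 0 ≤ ‖x - latVec n‖ ^ 2 - ‖x‖ ^ 2 := by linarith
        gcongr
      rw [sub_div, sub_div] at h4
      rw [neg_div, neg_div, neg_div]
      linarith
    calc _ ≤ ‖x - latVec n‖ * (Real.exp (-‖x‖ ^ 2 / (2 * t)) * Real.exp d * auxG 1 x n) := by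
          gcongr
      _ = _ := by ring
  have hZ0 : 0 ≤ ∑' n, auxG t x n := (Real.exp_pos _).le.trans hZ
  calc _ ≤ _ := h3
    _ ≤ ((∑' n, auxG t x n) * Real.exp d) * (Real.exp d * A) := by
        have h5 : 0 ≤ ∑' n, ‖x - latVec n‖ * auxG 1 x n :=
          tsum_nonneg fun n => mul_nonneg (norm_nonneg _) (auxG_pos 1 x n).le
        have h6 := h1.trans (mul_le_mul_of_nonneg_right h2 hA0)
        gcongr
    _ = (Real.exp d * (Real.exp d * A)) * ∑' n, auxG t x n := by ring
    _ ≤ _ := by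
        gcongr; linarith

lemma aux_reduce {d : ℕ} (x : EuclideanSpace ℝ (Fin d)) : ∃ (k : ZLat d),
    ‖x - latVec k‖ ^ 2 ≤ d ∧
    ∀ n : ZLat d, ‖x - latVec k‖ ^ 2 ≤ ‖x - latVec k - latVec n‖ ^ 2 := by
  refine ⟨fun i => round (x i), ?_, fun n => ?_⟩
  · rw [EuclideanSpace.real_norm_sq_eq]
    calc _ ≤ ∑ i : Fin d, (1 : ℝ) := by
          refine Finset.sum_le_sum fun i _ => ?_
          simp only [PiLp.sub_apply, aux_latVec_apply]
          have := abs_le.1 (abs_sub_round (x i))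
          nlinarith
      _ = d := by simp
  · rw [EuclideanSpace.real_norm_sq_eq, EuclideanSpace.real_norm_sq_eq]
    refine Finset.sum_le_sum fun i _ => ?_
    simp only [PiLp.sub_apply, aux_latVec_apply]
    have h := abs_le.1 (abs_sub_round (x i))
    have h2 : |(n i : ℝ)| ≤ (n i : ℝ) ^ 2 := by
      have : |n i| ≤ (n i) ^ 2 := by
        rw [← sq_abs]
        exact Int.le_self_sq _
      exact_mod_cast this
    set y := x i - (round (x i) : ℝ)
    have h3 : y * (n i : ℝ) ≤ 1 / 2 * |(n i : ℝ)| := by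
      calc _ ≤ |y * (n i : ℝ)| := le_abs_self _
        _ = |y| * |(n i : ℝ)| := abs_mul _ _
        _ ≤ _ := by gcongr; exact abs_le.2 h
    nlinarith

lemma aux_shift {d : ℕ} (x : EuclideanSpace ℝ (Fin d)) (k : ZLat d) (F : ℝ → ℝ) :
    ∑' n, F ‖x - latVec k - latVec n‖ = ∑' n, F ‖x - latVec n‖ := by
  rw [← (Equiv.addLeft k).tsum_eq (fun n => F ‖x - latVec n‖)]
  refine tsum_congr fun n => ?_
  congr 2
  ext i
  simp [latVec]
  ring

lemma aux_mean (d : ℕ) : ∃ C : ℝ, 0 < C ∧ ∀ (t : ℝ), 0 < t →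
    ∀ (x : EuclideanSpace ℝ (Fin d)),
    (t < 1 → ∑' n, ‖x - latVec n‖ * auxG t x n ≤ C * ∑' n, auxG t x n) ∧
    (1 ≤ t → ∑' n, ‖x - latVec n‖ * auxG t x n ≤ C * √t * ∑' n, auxG t x n) := by
  obtain ⟨C, hC, h⟩ := aux_small d
  have hp : 0 < Real.exp (2 * d) * 7 ^ d := by positivity
  refine ⟨C + Real.exp (2 * d) * 7 ^ d, by positivity, fun t ht x => ?_⟩
  obtain ⟨k, hk, hmin⟩ := aux_reduce x
  have e1 := aux_shift x k (fun r => r * Real.exp (-r ^ 2 / (2 * t)))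
  have e2 := aux_shift x k (fun r => Real.exp (-r ^ 2 / (2 * t)))
  have hZ0 : 0 ≤ ∑' n, auxG t (x - latVec k) n := tsum_nonneg fun n => (auxG_pos _ _ n).le
  simp only [← auxG.eq_1] at e1 e2
  rw [← e1, ← e2]
  constructor
  · intro h1
    refine (h t ht h1 _ hk hmin).trans ?_
    gcongr; linarith
  · intro h1
    refine (aux_large t h1 _ hk).trans ?_
    gcongr; linarith

/-- one-sided Lipschitz estimate through Jensen -/
lemma aux_jensen {d : ℕ} (t M : ℝ) (ht : 0 < t) (x y : EuclideanSpace ℝ (Fin d))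
    (hM : ∑' n, ‖x - latVec n‖ * auxG t x n ≤ M * ∑' n, auxG t x n) :
    Real.log (∑' n, auxG t x n) - Real.log (∑' n, auxG t y n) ≤
      (M + ‖y - x‖ / 2) / t * ‖y - x‖ := by
  set b := ‖y - x‖ with hb
  have hb0 : 0 ≤ b := norm_nonneg _
  set a := (M + b / 2) / t * b with ha
  have hsx := auxG_summable t ht x
  have hsy := auxG_summable t ht y
  have hrx := aux_rG_summable t ht x
  have hpx : 0 < ∑' n, auxG t x n := hsx.tsum_pos (fun n => (auxG_pos _ _ n).le) 0 (auxG_pos _ _ 0)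
  have hpy : 0 < ∑' n, auxG t y n := hsy.tsum_pos (fun n => (auxG_pos _ _ n).le) 0 (auxG_pos _ _ 0)
  have key : ∀ n : ZLat d, Real.exp (-a) * ((1 + a - b ^ 2 / (2 * t)) * auxG t x n
      - b / t * (‖x - latVec n‖ * auxG t x n)) ≤ auxG t y n := by
    intro n
    set r := ‖x - latVec n‖ with hr
    have h1 : ‖y - latVec n‖ ≤ r + b := by
      calc ‖y - latVec n‖ = ‖(x - latVec n) + (y - x)‖ := by congr 1; abel
        _ ≤ _ := norm_add_le _ _
    have hr0 : 0 ≤ r := norm_nonneg _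
    have h2 : ‖y - latVec n‖ ^ 2 ≤ (r + b) ^ 2 := by gcongr
    have h3 : auxG t x n * Real.exp (-(2 * r * b + b ^ 2) / (2 * t)) ≤ auxG t y n := by
      rw [auxG, auxG, ← Real.exp_add, ← add_div, ← hr]
      apply Real.exp_le_exp.2
      gcongr
      linarith
    refine le_trans ?_ h3
    have h4 := Real.add_one_le_exp (-(2 * r * b + b ^ 2) / (2 * t) + a)
    rw [Real.exp_add] at h4
    have h5 : Real.exp (-a) * (-(2 * r * b + b ^ 2) / (2 * t) + a + 1)
        ≤ Real.exp (-(2 * r * b + b ^ 2) / (2 * t)) := by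
      rw [Real.exp_neg, inv_mul_le_iff₀ (Real.exp_pos _)]; linarith
    have h6 := mul_le_mul_of_nonneg_left h5 (auxG_pos t x n).le
    refine le_trans (le_of_eq ?_) h6
    field_simp
    ring
  have hsum := ((hsx.mul_left (1 + a - b ^ 2 / (2 * t))).sub (hrx.mul_left (b / t))).mul_left
    (Real.exp (-a))
  have h7 := hsum.tsum_le_tsum key hsy
  rw [tsum_mul_left, ((hsx.mul_left (1 + a - b ^ 2 / (2 * t))).tsum_sub (hrx.mul_left (b / t))),
    tsum_mul_left, tsum_mul_left] at h7
  have h8 : Real.exp (-a) * ∑' n, auxG t x n ≤ ∑' n, auxG t y n := by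
    refine le_trans ?_ h7
    gcongr
    have h9 : b / t * ∑' n, ‖x - latVec n‖ * auxG t x n ≤ b / t * (M * ∑' n, auxG t x n) := by
      gcongr
    have h10 : (1 + a - b ^ 2 / (2 * t)) * ∑' n, auxG t x n =
        ∑' n, auxG t x n + b / t * (M * ∑' n, auxG t x n) := by
      rw [ha]; field_simp; ring
    linarith
  have h11 := Real.log_le_log (by positivity) h8
  rw [Real.log_mul (Real.exp_pos _).ne' hpx.ne', Real.log_exp] at h11
  linarith

lemma aux_fderiv {d : ℕ} (t M : ℝ) (ht : 0 < t) (hM0 : 0 ≤ M)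
    (hM : ∀ x : EuclideanSpace ℝ (Fin d),
      ∑' n, ‖x - latVec n‖ * auxG t x n ≤ M * ∑' n, auxG t x n)
    (x : EuclideanSpace ℝ (Fin d)) :
    ‖fderiv ℝ (fun y => Real.log (pHeatK d t y)) x‖ ≤ (M + 1 / 2) / t := by
  have hc : 0 < (2 * π * t) ^ (-(d : ℝ) / 2) := by positivity
  have hlog : ∀ y : EuclideanSpace ℝ (Fin d), Real.log (pHeatK d t y) =
      Real.log ((2 * π * t) ^ (-(d : ℝ) / 2)) + Real.log (∑' n, auxG t y n) := by
    intro y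
    have hpy : 0 < ∑' n, auxG t y n :=
      (auxG_summable t ht y).tsum_pos (fun n => (auxG_pos _ _ n).le) 0 (auxG_pos _ _ 0)
    rw [← Real.log_mul hc.ne' hpy.ne', ← tsum_mul_left]
    rfl
  refine norm_fderiv_le_of_lip' ℝ (by positivity) ?_
  filter_upwards [Metric.ball_mem_nhds x one_pos] with y hy
  rw [Metric.mem_ball, dist_eq_norm] at hy
  simp only [hlog]
  have h1 := aux_jensen t M ht x y (hM x)
  have h2 := aux_jensen t M ht y x (hM y)
  rw [norm_sub_rev x y] at h2
  have h3 : (M + ‖y - x‖ / 2) / t * ‖y - x‖ ≤ (M + 1 / 2) / t * ‖y - x‖ := by gcongr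
  rw [Real.norm_eq_abs, abs_le]
  constructor <;> linarith

theorem stmt4 (d : ℕ) (hd : 1 ≤ d) :
    ∃ C₁ C₂ : ℝ, 0 < C₁ ∧ 0 < C₂ ∧
      ∀ (x : EuclideanSpace ℝ (Fin d)) (t : ℝ), 0 < t →
        (t < 1 → ‖fderiv ℝ (fun y => Real.log (pHeatK d t y)) x‖ ≤ C₁ / t) ∧
        (1 ≤ t → ‖fderiv ℝ (fun y => Real.log (pHeatK d t y)) x‖ ≤ C₂ / Real.sqrt t) := by
  obtain ⟨C, hC, h⟩ := aux_mean d
  refine ⟨C + 1 / 2, C + 1 / 2, by positivity, by positivity, fun x t ht => ⟨fun h1 => ?_, fun h1 => ?_⟩⟩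
  · exact aux_fderiv t C ht hC.le (fun y => (h t ht y).1 h1) x
  · have hs : 1 ≤ √t := Real.one_le_sqrt.2 h1
    refine (aux_fderiv t (C * √t) ht (by positivity) (fun y => (h t ht y).2 h1) x).trans ?_
    have e : (C + 1 / 2) / √t = (C * √t + 1 / 2 * √t) / t := by
      rw [← add_mul, div_eq_div_iff (by positivity) ht.ne', mul_assoc, Real.mul_self_sqrt ht.le]
    rw [e]
    gcongr
    linarith

end
end

section
/- For all x ∈ ℝ and all t ≥ 1: θ(x,t) ≥ (e^{2π²} − 3)/(e^{2π²} − 1) > 0, and the derivative of θ in its first variable satisfies |∂_x θ(x,t)| ≤ 1/(π√t). -/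
open MeasureTheory Real Filter

noncomputable section

/-- The Jacobi theta function θ(x,t) = Σ_{n ∈ ℤ} (2πt)^{-1/2} exp(-(x-n)²/(2t)). -/
def theta (x t : ℝ) : ℝ :=
  ∑' n : ℤ, (2 * π * t) ^ (-(1 : ℝ) / 2) * Real.exp (-(x - (n : ℝ)) ^ 2 / (2 * t))

lemma theta_hasSum (x t : ℝ) (ht : 0 < t) :
    HasSum (fun n : ℕ => 2 * Real.cos (2 * π * x * (n + 1)) *
      Real.exp (-π * (n + 1) ^ 2 * (2 * π * t))) (theta x t - 1) := by
  have hpos : 0 < 2 * π * t := by positivity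
  have h1 := HurwitzZeta.hasSum_nat_cosKernel₀ x hpos
  have h2 := HurwitzZeta.hasSum_int_evenKernel x (t := 1 / (2 * π * t)) (by positivity)
  have h3 := (Equiv.neg ℤ).hasSum_iff.mpr h2
  have h4 := (h3.mul_left ((2 * π * t) ^ (-(1 : ℝ) / 2))).tsum_eq
  have h5 : theta x t = HurwitzZeta.cosKernel x (2 * π * t) := by
    unfold theta
    rw [HurwitzZeta.evenKernel_functional_equation] at h4
    rw [one_div_one_div] at h4
    have h6 : (2 * π * t) ^ (-(1 : ℝ) / 2) * (1 / (1 / (2 * π * t)) ^ (1 / 2 : ℝ) *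
        HurwitzZeta.cosKernel x (2 * π * t)) = HurwitzZeta.cosKernel x (2 * π * t) := by
      rw [one_div (2 * π * t), Real.inv_rpow hpos.le, one_div, inv_inv, ← mul_assoc,
        ← Real.rpow_add hpos]
      norm_num
    rw [h6] at h4
    rw [← h4]
    refine tsum_congr fun n => ?_
    simp only [Function.comp, Equiv.neg_apply, Int.cast_neg]
    congr 2
    field_simp
    ring
  rw [h5]
  exact h1

lemma geom_hasSum (c : ℝ) (hc : 0 < c) :
    HasSum (fun n : ℕ => Real.exp (-c * (n + 1))) (1 / (Real.exp c - 1)) := by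
  have hlt : Real.exp (-c) < 1 := by simpa using hc
  have h := (hasSum_geometric_of_lt_one (Real.exp_pos _).le hlt).mul_left (Real.exp (-c))
  have hE : 1 < Real.exp c := by simpa using hc
  have e1 : (fun n : ℕ => Real.exp (-c * (n + 1))) =
      fun n : ℕ => Real.exp (-c) * Real.exp (-c) ^ n := by
    funext n
    rw [← Real.exp_nat_mul, ← Real.exp_add]
    congr 1
    ring
  have e2 : 1 / (Real.exp c - 1) = Real.exp (-c) * (1 - Real.exp (-c))⁻¹ := by
    rw [Real.exp_neg]
    have : Real.exp c - 1 ≠ 0 := by linarith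
    field_simp
  rw [e1, e2]
  exact h

lemma pi_sq_gt : 9 < π ^ 2 := by nlinarith [Real.pi_gt_three]

lemma exp_gt : 9 < Real.exp (π ^ 2) := by
  linarith [Real.add_one_le_exp (π ^ 2), pi_sq_gt]

lemma exp_gt2 : 9 < Real.exp (2 * π ^ 2) := by
  linarith [Real.add_one_le_exp (2 * π ^ 2), pi_sq_gt]

lemma sq_ge_aux (n : ℕ) (t : ℝ) (ht : 1 ≤ t) : (n : ℝ) + 1 ≤ (n + 1) ^ 2 * t := by
  have h : (0 : ℝ) ≤ n := n.cast_nonneg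
  nlinarith [mul_nonneg (sq_nonneg ((n : ℝ) + 1)) (sub_nonneg.2 ht)]

lemma theta_lower (x t : ℝ) (ht : 1 ≤ t) :
    (Real.exp (2 * π ^ 2) - 3) / (Real.exp (2 * π ^ 2) - 1) ≤ theta x t := by
  have h1 := theta_hasSum x t (by linarith)
  have h2 := (geom_hasSum (2 * π ^ 2) (by positivity)).mul_left (-2)
  have h3 := hasSum_le (fun n => ?_) h2 h1
  · have hE := exp_gt2
    have h4 : (Real.exp (2 * π ^ 2) - 3) / (Real.exp (2 * π ^ 2) - 1)
        = 1 + -2 * (1 / (Real.exp (2 * π ^ 2) - 1)) := by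
      have : Real.exp (2 * π ^ 2) - 1 ≠ 0 := by linarith
      field_simp
      ring
    linarith
  · have h5 : Real.exp (-π * (n + 1) ^ 2 * (2 * π * t)) ≤ Real.exp (-(2 * π ^ 2) * (n + 1)) := by
      apply Real.exp_le_exp.2
      have := mul_le_mul_of_nonneg_left (sq_ge_aux n t ht) (by positivity : 0 ≤ 2 * π ^ 2)
      nlinarith
    have h6 := Real.neg_one_le_cos (2 * π * x * (n + 1))
    have h7 := Real.exp_pos (-π * (n + 1) ^ 2 * (2 * π * t))
    nlinarith

lemma term_bound (n : ℕ) (t : ℝ) (ht : 1 ≤ t) :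
    4 * π * (n + 1) * Real.exp (-π * (n + 1) ^ 2 * (2 * π * t)) ≤
      4 / (π * Real.sqrt t) * Real.exp (-(π ^ 2) * (n + 1)) := by
  have hs : 0 < Real.sqrt t := Real.sqrt_pos.2 (by linarith)
  have hst : Real.sqrt t ≤ t := by
    rw [Real.sqrt_le_left (by linarith)]
    nlinarith
  have hn : (0 : ℝ) ≤ n := n.cast_nonneg
  set s : ℝ := (n + 1) ^ 2 * t with hsd
  have hns : (n + 1 : ℝ) ≤ s := sq_ge_aux n t ht
  have h1 : (n + 1 : ℝ) * Real.sqrt t ≤ s := by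
    have : (n + 1 : ℝ) ≤ (n + 1) ^ 2 := by nlinarith
    exact mul_le_mul this hst hs.le (by positivity)
  have h2 : π ^ 2 * s ≤ Real.exp (π ^ 2 * s) := by
    linarith [Real.add_one_le_exp (π ^ 2 * s)]
  have h3 : Real.exp (-π * (n + 1) ^ 2 * (2 * π * t)) =
      Real.exp (-(π ^ 2 * s)) * Real.exp (-(π ^ 2 * s)) := by
    rw [← Real.exp_add]
    congr 1
    rw [hsd]
    ring
  have h4 : Real.exp (-(π ^ 2 * s)) ≤ Real.exp (-(π ^ 2) * (n + 1)) := by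
    apply Real.exp_le_exp.2
    have := mul_le_mul_of_nonneg_left hns (by positivity : 0 ≤ π ^ 2)
    linarith
  have h5 : π ^ 2 * ((n + 1) * Real.sqrt t) * Real.exp (-(π ^ 2 * s)) ≤ 1 := by
    have h6 : π ^ 2 * ((n + 1) * Real.sqrt t) ≤ Real.exp (π ^ 2 * s) :=
      (mul_le_mul_of_nonneg_left h1 (by positivity)).trans h2
    calc _ ≤ Real.exp (π ^ 2 * s) * Real.exp (-(π ^ 2 * s)) := by gcongr
      _ = 1 := by rw [← Real.exp_add]; simp
  rw [h3]
  calc 4 * π * (n + 1) * (Real.exp (-(π ^ 2 * s)) * Real.exp (-(π ^ 2 * s)))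
      = 4 / (π * Real.sqrt t) * ((π ^ 2 * ((n + 1) * Real.sqrt t) * Real.exp (-(π ^ 2 * s))) *
        Real.exp (-(π ^ 2 * s))) := by
        field_simp
    _ ≤ 4 / (π * Real.sqrt t) * (1 * Real.exp (-(π ^ 2) * (n + 1))) := by gcongr
    _ = _ := by rw [one_mul]

lemma theta_lip (x y t : ℝ) (ht : 1 ≤ t) :
    ‖theta y t - theta x t‖ ≤ 1 / (π * Real.sqrt t) * ‖y - x‖ := by
  have hs : 0 < Real.sqrt t := Real.sqrt_pos.2 (by linarith)
  have h1 := (theta_hasSum y t (by linarith)).sub (theta_hasSum x t (by linarith))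
  have h2 := ((geom_hasSum (π ^ 2) (by positivity)).mul_left
    (4 / (π * Real.sqrt t))).mul_right ‖y - x‖
  have h3 := tsum_of_norm_bounded h2 (fun n => ?_) (f := fun n : ℕ =>
    2 * Real.cos (2 * π * y * (n + 1)) * Real.exp (-π * (n + 1) ^ 2 * (2 * π * t)) -
    2 * Real.cos (2 * π * x * (n + 1)) * Real.exp (-π * (n + 1) ^ 2 * (2 * π * t)))
  · rw [h1.tsum_eq] at h3
    rw [sub_sub_sub_cancel_right] at h3
    refine h3.trans ?_
    gcongr
    have hE := exp_gt
    rw [div_mul_div_comm, div_le_div_iff₀ (mul_pos (by positivity) (by linarith)) (by positivity)]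
    nlinarith [mul_pos Real.pi_pos hs]
  · have hn : (0 : ℝ) ≤ n := n.cast_nonneg
    have hc := Real.abs_cos_sub_cos_le (2 * π * y * (n + 1)) (2 * π * x * (n + 1))
    have hc2 : |2 * π * y * (n + 1) - 2 * π * x * (n + 1)| = 2 * π * (n + 1) * |y - x| := by
      rw [show 2 * π * y * (n + 1) - 2 * π * x * (n + 1) = 2 * π * (n + 1) * (y - x) by ring,
        abs_mul, abs_of_nonneg (by positivity)]
    rw [hc2] at hc
    rw [← sub_mul, ← mul_sub, norm_mul, norm_mul, Real.norm_of_nonneg (Real.exp_pos _).le,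
      Real.norm_eq_abs, Real.norm_eq_abs, Real.norm_eq_abs, abs_two]
    calc _ ≤ 2 * (2 * π * (n + 1) * |y - x|) * Real.exp (-π * (n + 1) ^ 2 * (2 * π * t)) := by
          gcongr
      _ = (4 * π * (n + 1) * Real.exp (-π * (n + 1) ^ 2 * (2 * π * t))) * |y - x| := by ring
      _ ≤ _ := 
          mul_le_mul_of_nonneg_right (term_bound n t ht) (abs_nonneg _)

theorem stmt13 (x t : ℝ) (ht : 1 ≤ t) :
    ((Real.exp (2 * π ^ 2) - 3) / (Real.exp (2 * π ^ 2) - 1) ≤ theta x t ∧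
      0 < (Real.exp (2 * π ^ 2) - 3) / (Real.exp (2 * π ^ 2) - 1)) ∧
    |deriv (fun y => theta y t) x| ≤ 1 / (π * Real.sqrt t) := by
  refine ⟨⟨theta_lower x t ht, ?_⟩, ?_⟩
  · have := exp_gt2
    exact div_pos (by linarith) (by linarith)
  · rw [← Real.norm_eq_abs]
    exact norm_deriv_le_of_lip' (by positivity) (Filter.Eventually.of_forall
      fun y => theta_lip x y t ht)

end
end
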